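/- arXiv:2505.23216 — 8 statements merged into one kernel-verified Lean document; each statement's English description precedes it below -/
import Mathlib

section
/- For every sequence w : ℤ → ℂ with Σ_{n∈ℤ} (1+α_n²)^{1/2} |w_n|² < ∞, the series S := L·Σ_{n∈ℤ} i·β_n·|w_n|² converges absolutely, the set {n ∈ ℤ : α_n² < k²ε} is finite, and Im S = L·Σ_{n : α_n² < k²ε} √(k²ε − α_n²)·|w_n|², which is ≥ 0. -/
/-- Only finitely many terms of a nonconstant arithmetic progression have square below `c`. -/
theorem finite_setOf_sq_add_mul_int_lt (a d c : ℝ) (hd : d ≠ 0) :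
    {n : ℤ | (a + d * n) ^ 2 < c}.Finite := by
  set B : ℝ := (|a| + Real.sqrt c) / |d|
  refine (Set.finite_Icc (-⌈B⌉) ⌈B⌉).subset fun n hn => ?_
  have h1 : |a + d * n| ≤ Real.sqrt c := Real.abs_le_sqrt (le_of_lt hn)
  have h2 : |(n : ℝ)| ≤ B := by
    rw [le_div_iff₀ (abs_pos.mpr hd), mul_comm, ← abs_mul]
    calc |d * n| = |(a + d * n) - a| := by ring_nf
      _ ≤ |a + d * n| + |a| := abs_sub _ _
      _ ≤ |a| + Real.sqrt c := by linarith
  have h3 := abs_le.mp (h2.trans (Int.le_ceil B))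
  exact ⟨by exact_mod_cast h3.1, by exact_mod_cast h3.2⟩

/-- The Dirichlet-to-Neumann coefficient grows at most like `√(1 + x²)`. -/
theorem norm_dtn_coeff_le (c x : ℝ) (hc : 0 ≤ c) :
    ‖(if x ^ 2 ≤ c then (Real.sqrt (c - x ^ 2) : ℂ)
      else Complex.I * (Real.sqrt (x ^ 2 - c) : ℂ))‖ ≤
      Real.sqrt (1 + c) * Real.sqrt (1 + x ^ 2) := by
  rw [← Real.sqrt_mul (by positivity)]
  have hx := sq_nonneg x
  have hcx := mul_nonneg hc hx
  split_ifs <;>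
    simp only [norm_mul, Complex.norm_I, one_mul, Complex.norm_real, Real.norm_eq_abs,
      abs_of_nonneg (Real.sqrt_nonneg _)] <;>
    exact Real.sqrt_le_sqrt (by nlinarith)

/-- The real part of the Dirichlet-to-Neumann coefficient lives on the propagating modes. -/
theorem re_dtn_coeff (c x : ℝ) :
    (if x ^ 2 ≤ c then (Real.sqrt (c - x ^ 2) : ℂ)
      else Complex.I * (Real.sqrt (x ^ 2 - c) : ℂ)).re =
      if x ^ 2 < c then Real.sqrt (c - x ^ 2) else 0 := by
  rcases lt_trichotomy (x ^ 2) c with h | h | h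
  · simp [h, h.le]
  · simp [h]
  · simp [h.not_ge, h.le.not_gt]

/-- Lemma 3.5, first identity: sign of the imaginary part of the DtN form.
Fix `L > 0`, `α₀ ∈ ℝ`, `k > 0`, real permittivity `ε > 0`; `α n = α₀ + 2πn/L` and
`β n = √(k²ε − α_n²)` if `α_n² ≤ k²ε`, `β n = i√(α_n² − k²ε)` otherwise.
For every `w : ℤ → ℂ` with `Σ (1+α_n²)^{1/2}|w_n|² < ∞`, the series
`S = L Σ i β_n |w_n|²` converges absolutely, the set `{n | α_n² < k²ε}` is finite, and
`Im S = L Σ_{α_n² < k²ε} √(k²ε − α_n²)|w_n|² ≥ 0`. -/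
theorem dtn_form_imaginary_part
    (L α₀ k ε : ℝ) (hL : 0 < L) (hk : 0 < k) (hε : 0 < ε)
    (α : ℤ → ℝ) (hα : ∀ n : ℤ, α n = α₀ + 2 * Real.pi * n / L)
    (β : ℤ → ℂ)
    (hβ : ∀ n : ℤ, β n =
      if (α n) ^ 2 ≤ k ^ 2 * ε then (Real.sqrt (k ^ 2 * ε - (α n) ^ 2) : ℂ)
      else Complex.I * (Real.sqrt ((α n) ^ 2 - k ^ 2 * ε) : ℂ))
    (w : ℤ → ℂ)
    (hw : Summable (fun n : ℤ => Real.sqrt (1 + (α n) ^ 2) * ‖w n‖ ^ 2)) :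
    Summable (fun n : ℤ => ‖(L : ℂ) * (Complex.I * β n * (‖w n‖ : ℂ) ^ 2)‖) ∧
    {n : ℤ | (α n) ^ 2 < k ^ 2 * ε}.Finite ∧
    (∑' n : ℤ, (L : ℂ) * (Complex.I * β n * (‖w n‖ : ℂ) ^ 2)).im =
      L * ∑' n : ℤ,
        (if (α n) ^ 2 < k ^ 2 * ε then Real.sqrt (k ^ 2 * ε - (α n) ^ 2) * ‖w n‖ ^ 2 else 0) ∧
    0 ≤ L * ∑' n : ℤ,
        (if (α n) ^ 2 < k ^ 2 * ε then Real.sqrt (k ^ 2 * ε - (α n) ^ 2) * ‖w n‖ ^ 2 else 0) := by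
  have hsum : Summable (fun n : ℤ => ‖(L : ℂ) * (Complex.I * β n * (‖w n‖ : ℂ) ^ 2)‖) := by
    refine Summable.of_nonneg_of_le (fun n => norm_nonneg _) (fun n => ?_)
      (hw.mul_left (L * Real.sqrt (1 + k ^ 2 * ε)))
    have hb : ‖β n‖ ≤ Real.sqrt (1 + k ^ 2 * ε) * Real.sqrt (1 + (α n) ^ 2) := by
      rw [hβ n]
      exact norm_dtn_coeff_le _ _ (by positivity)
    calc ‖(L : ℂ) * (Complex.I * β n * (‖w n‖ : ℂ) ^ 2)‖ = L * (‖β n‖ * ‖w n‖ ^ 2) := by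
          simp [abs_of_pos hL]
      _ ≤ L * (Real.sqrt (1 + k ^ 2 * ε) * Real.sqrt (1 + (α n) ^ 2) * ‖w n‖ ^ 2) := by
          gcongr
      _ = _ := by ring
  refine ⟨hsum, ?_, ?_, ?_⟩
  · have hd : 2 * Real.pi / L ≠ 0 := by positivity
    convert finite_setOf_sq_add_mul_int_lt α₀ (2 * Real.pi / L) (k ^ 2 * ε) hd using 4 with n
    rw [hα n]
    ring
  · rw [Complex.im_tsum hsum.of_norm, ← tsum_mul_left]
    refine tsum_congr fun n => ?_
    have hre : (β n).re =
        if (α n) ^ 2 < k ^ 2 * ε then Real.sqrt (k ^ 2 * ε - (α n) ^ 2) else 0 := by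
      rw [hβ n]
      exact re_dtn_coeff _ _
    rw [← Complex.ofReal_pow, Complex.im_ofReal_mul, Complex.im_mul_ofReal, Complex.I_mul_im,
      hre, ite_mul, zero_mul]
  · refine mul_nonneg hL.le (tsum_nonneg fun n => ?_)
    split_ifs <;> positivity
end

section
/- Let w : ℤ → ℂ satisfy Σ_{n∈ℤ} (1+α_n²)^{1/2} |w_n|² < ∞, and for M ∈ ℕ set S := L·Σ_{n∈ℤ} i·β_n·|w_n|² and S_M := L·Σ_{|n|≤M} i·β_n·|w_n|². Then Im S ≥ Im S_M ≥ 0 and Re S ≤ Re S_M ≤ 0. -/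
/- The conditional below is the square root of `x - y` with non-negative real and imaginary parts. -/
lemma ite_sqrt_re_nonneg (x y : ℝ) :
    0 ≤ (if y ≤ x then (Real.sqrt (x - y) : ℂ)
      else Complex.I * (Real.sqrt (y - x) : ℂ)).re := by
  split_ifs <;> simp [Real.sqrt_nonneg]

lemma ite_sqrt_im_nonneg (x y : ℝ) :
    0 ≤ (if y ≤ x then (Real.sqrt (x - y) : ℂ)
      else Complex.I * (Real.sqrt (y - x) : ℂ)).im := by
  split_ifs <;> simp [Real.sqrt_nonneg]

lemma norm_ite_sqrt_le {x y : ℝ} (hx : 0 ≤ x) (hy : 0 ≤ y) :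
    ‖(if y ≤ x then (Real.sqrt (x - y) : ℂ)
      else Complex.I * (Real.sqrt (y - x) : ℂ))‖ ≤ Real.sqrt (1 + x) * Real.sqrt (1 + y) := by
  rw [← Real.sqrt_mul (by positivity)]
  split_ifs
  · rw [Complex.norm_real, Real.norm_of_nonneg (Real.sqrt_nonneg _)]
    exact Real.sqrt_le_sqrt (by nlinarith [mul_nonneg hx hy])
  · rw [norm_mul, Complex.norm_I, one_mul, Complex.norm_real,
      Real.norm_of_nonneg (Real.sqrt_nonneg _)]
    exact Real.sqrt_le_sqrt (by nlinarith [mul_nonneg hx hy])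

/-- For a summable family in the second quadrant, partial sums are also in the second quadrant
and the remainder is too. -/
lemma sum_tsum_second_quadrant {ι : Type*} {f : ι → ℂ} (hf : Summable f)
    (hre : ∀ i, (f i).re ≤ 0) (him : ∀ i, 0 ≤ (f i).im) (s : Finset ι) :
    ((∑ i ∈ s, f i).im ≤ (∑' i, f i).im ∧ 0 ≤ (∑ i ∈ s, f i).im) ∧
      ((∑' i, f i).re ≤ (∑ i ∈ s, f i).re ∧ (∑ i ∈ s, f i).re ≤ 0) := by
  have hsre := Complex.hasSum_re hf.hasSum
  have hsim := Complex.hasSum_im hf.hasSum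
  rw [Complex.re_sum, Complex.im_sum]
  refine ⟨⟨sum_le_hasSum s (fun i _ => him i) hsim, Finset.sum_nonneg fun i _ => him i⟩, ?_,
    Finset.sum_nonpos fun i _ => hre i⟩
  simpa using sum_le_hasSum s (fun i _ => neg_nonneg.2 (hre i)) hsre.neg

/-- Lemma 3.5, comparison between the full DtN form `S = L Σ_{n∈ℤ} i β_n |w_n|²`
and its truncation `S_M = L Σ_{|n|≤M} i β_n |w_n|²`:
`Im S ≥ Im S_M ≥ 0` and `Re S ≤ Re S_M ≤ 0`. -/
theorem dtn_form_truncation_comparison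
    (L α₀ k ε : ℝ) (hL : 0 < L) (hk : 0 < k) (hε : 0 < ε)
    (α : ℤ → ℝ) (hα : ∀ n : ℤ, α n = α₀ + 2 * Real.pi * n / L)
    (β : ℤ → ℂ)
    (hβ : ∀ n : ℤ, β n =
      if (α n) ^ 2 ≤ k ^ 2 * ε then (Real.sqrt (k ^ 2 * ε - (α n) ^ 2) : ℂ)
      else Complex.I * (Real.sqrt ((α n) ^ 2 - k ^ 2 * ε) : ℂ))
    (w : ℤ → ℂ)
    (hw : Summable (fun n : ℤ => Real.sqrt (1 + (α n) ^ 2) * ‖w n‖ ^ 2))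
    (M : ℕ)
    (S S_M : ℂ)
    (hS : S = (L : ℂ) * ∑' n : ℤ, Complex.I * β n * (‖w n‖ : ℂ) ^ 2)
    (hS_M : S_M = (L : ℂ) * ∑ n ∈ Finset.Icc (-(M : ℤ)) (M : ℤ),
      Complex.I * β n * (‖w n‖ : ℂ) ^ 2) :
    (S_M.im ≤ S.im ∧ 0 ≤ S_M.im) ∧ (S.re ≤ S_M.re ∧ S_M.re ≤ 0) := by
  have hre : ∀ n, 0 ≤ (β n).re := fun n => by rw [hβ n]; exact ite_sqrt_re_nonneg _ _
  have him : ∀ n, 0 ≤ (β n).im := fun n => by rw [hβ n]; exact ite_sqrt_im_nonneg _ _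
  have hnorm : ∀ n, ‖β n‖ ≤ Real.sqrt (1 + k ^ 2 * ε) * Real.sqrt (1 + (α n) ^ 2) := fun n => by
    rw [hβ n]
    exact norm_ite_sqrt_le (by positivity) (by positivity)
  have hsum : Summable fun n : ℤ => Complex.I * β n * (‖w n‖ : ℂ) ^ 2 := by
    refine Summable.of_norm_bounded (hw.mul_left (Real.sqrt (1 + k ^ 2 * ε))) fun n => ?_
    rw [norm_mul, norm_mul, Complex.norm_I, one_mul, norm_pow, Complex.norm_real, norm_norm,
      ← mul_assoc]
    exact mul_le_mul_of_nonneg_right (hnorm n) (by positivity)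
  obtain ⟨⟨h₁, h₂⟩, h₃, h₄⟩ := sum_tsum_second_quadrant hsum
    (fun n => by
      rw [← Complex.ofReal_pow, Complex.re_mul_ofReal, Complex.I_mul_re]
      exact mul_nonpos_of_nonpos_of_nonneg (neg_nonpos.2 (him n)) (by positivity))
    (fun n => by
      rw [← Complex.ofReal_pow, Complex.im_mul_ofReal, Complex.I_mul_im]
      exact mul_nonneg (hre n) (by positivity))
    (Finset.Icc (-(M : ℤ)) (M : ℤ))
  rw [hS, hS_M]
  simp only [Complex.re_ofReal_mul, Complex.im_ofReal_mul]
  exact ⟨⟨mul_le_mul_of_nonneg_left h₁ hL.le, mul_nonneg hL.le h₂⟩,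
    mul_le_mul_of_nonneg_left h₃ hL.le, mul_nonpos_of_nonneg_of_nonpos hL.le h₄⟩
end

section
/- Let M ∈ ℕ satisfy M ≥ (L/(2π))·(k√ε + |α₀|). Then for every n ∈ ℤ with |n| > M one has α_n² > k²ε (so β_n is purely imaginary), and consequently for every sequence w : ℤ → ℂ with Σ_{n∈ℤ} (1+α_n²)^{1/2} |w_n|² < ∞ one has Im( L·Σ_{|n|≤M} i·β_n·|w_n|² ) = Im( L·Σ_{n∈ℤ} i·β_n·|w_n|² ). -/
/-- A mode whose index exceeds the threshold is evanescent. -/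
lemma sq_wavenumber_lt_of_threshold {L α₀ k ε x m : ℝ} (hL : 0 < L) (hk : 0 < k) (hε : 0 < ε)
    (hm : L / (2 * Real.pi) * (k * Real.sqrt ε + |α₀|) ≤ m) (hx : m < |x|) :
    k ^ 2 * ε < (α₀ + 2 * Real.pi * x / L) ^ 2 := by
  have hc : 0 < 2 * Real.pi / L := by positivity
  have h1 : k * Real.sqrt ε + |α₀| < 2 * Real.pi / L * |x| := by
    calc k * Real.sqrt ε + |α₀|
        = 2 * Real.pi / L * (L / (2 * Real.pi) * (k * Real.sqrt ε + |α₀|)) := by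
          field_simp
      _ < 2 * Real.pi / L * |x| := mul_lt_mul_of_pos_left (hm.trans_lt hx) hc
  have h2 : |2 * Real.pi * x / L| = 2 * Real.pi / L * |x| := by
    rw [mul_div_right_comm, abs_mul, abs_of_pos hc]
  have h3 : |2 * Real.pi * x / L| ≤ |α₀ + 2 * Real.pi * x / L| + |α₀| := by
    simpa using abs_sub (α₀ + 2 * Real.pi * x / L) α₀
  have h4 : (k * Real.sqrt ε) ^ 2 = k ^ 2 * ε := by
    rw [mul_pow, Real.sq_sqrt hε.le]
  rw [← h4, ← sq_abs (α₀ + _)]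
  exact pow_lt_pow_left₀ (by linarith) (by positivity) two_ne_zero

/-- The DtN coefficients grow at most like `√(1 + a²)`. -/
lemma norm_dtn_coefficient_le {a c : ℝ} (hc : 0 ≤ c) :
    ‖(if a ^ 2 ≤ c then (Real.sqrt (c - a ^ 2) : ℂ)
      else Complex.I * (Real.sqrt (a ^ 2 - c) : ℂ))‖ ≤
      Real.sqrt (1 + c) * Real.sqrt (1 + a ^ 2) := by
  have ha := sq_nonneg a
  rw [← Real.sqrt_mul (by positivity)]
  split_ifs
  · rw [Complex.norm_real, Real.norm_of_nonneg (Real.sqrt_nonneg _)]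
    exact Real.sqrt_le_sqrt (by nlinarith)
  · rw [norm_mul, Complex.norm_I, one_mul, Complex.norm_real,
      Real.norm_of_nonneg (Real.sqrt_nonneg _)]
    exact Real.sqrt_le_sqrt (by nlinarith)


/-- Remark 2.6: if `M ≥ (L/2π)(k√ε + |α₀|)` then every mode with `|n| > M` is evanescent
(`α_n² > k²ε`, so `β_n` is purely imaginary), and the truncated DtN form has the same
imaginary part as the full one. -/
theorem dtn_truncated_same_imaginary_part
    (L α₀ k ε : ℝ) (hL : 0 < L) (hk : 0 < k) (hε : 0 < ε)
    (α : ℤ → ℝ) (hα : ∀ n : ℤ, α n = α₀ + 2 * Real.pi * n / L)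
    (β : ℤ → ℂ)
    (hβ : ∀ n : ℤ, β n =
      if (α n) ^ 2 ≤ k ^ 2 * ε then (Real.sqrt (k ^ 2 * ε - (α n) ^ 2) : ℂ)
      else Complex.I * (Real.sqrt ((α n) ^ 2 - k ^ 2 * ε) : ℂ))
    (M : ℕ)
    (hM : (L / (2 * Real.pi)) * (k * Real.sqrt ε + |α₀|) ≤ M) :
    (∀ n : ℤ, (M : ℤ) < |n| → k ^ 2 * ε < (α n) ^ 2 ∧ (β n).re = 0) ∧
    (∀ w : ℤ → ℂ, Summable (fun n : ℤ => Real.sqrt (1 + (α n) ^ 2) * ‖w n‖ ^ 2) →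
      ((L : ℂ) * ∑ n ∈ Finset.Icc (-(M : ℤ)) (M : ℤ),
          Complex.I * β n * (‖w n‖ : ℂ) ^ 2).im =
        ((L : ℂ) * ∑' n : ℤ, Complex.I * β n * (‖w n‖ : ℂ) ^ 2).im) := by
  have hev : ∀ n : ℤ, (M : ℤ) < |n| → k ^ 2 * ε < (α n) ^ 2 ∧ (β n).re = 0 := by
    intro n hn
    have h : k ^ 2 * ε < (α n) ^ 2 := by
      rw [hα]
      exact sq_wavenumber_lt_of_threshold hL hk hε hM (by exact_mod_cast hn)
    refine ⟨h, ?_⟩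
    rw [hβ, if_neg h.not_ge]
    simp
  refine ⟨hev, fun w hw => ?_⟩
  have hsum : Summable fun n : ℤ => Complex.I * β n * (‖w n‖ : ℂ) ^ 2 := by
    refine .of_norm_bounded (hw.mul_left (Real.sqrt (1 + k ^ 2 * ε))) fun n => ?_
    rw [norm_mul, norm_mul, Complex.norm_I, one_mul, norm_pow, Complex.norm_real, norm_norm,
      ← mul_assoc, hβ]
    gcongr
    exact norm_dtn_coefficient_le (by positivity)
  rw [Complex.im_ofReal_mul, Complex.im_ofReal_mul, Complex.im_tsum hsum, Complex.im_sum,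
    tsum_eq_sum]
  intro n hn
  have hn' : (M : ℤ) < |n| := by
    rwa [Finset.mem_Icc, ← abs_le, not_le] at hn
  rw [← Complex.ofReal_pow, Complex.im_mul_ofReal, Complex.I_mul_im, (hev n hn').2, zero_mul]
end

section
/- Let s ∈ ℝ, t > 0, and let M ∈ ℕ satisfy M ≥ (L/(2π))·(k√ε + |α₀|). Then for every sequence φ : ℤ → ℂ with L·Σ_{n∈ℤ} (1+α_n²)^{s+t} |φ_n|² < ∞, one has L·Σ_{|n|>M} (1+α_n²)^{s−1} |β_n|² |φ_n|² ≤ (2πM/L − |α₀|)^{−2t} · L·Σ_{n∈ℤ} (1+α_n²)^{s+t} |φ_n|². In particular the truncation error T − T_M in the Fourier-weighted norms decays algebraically in M. -/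
/-- Above the cut-off, the squared DtN coefficient `|β|² = a² - c` is at most `1 + a²`. -/
theorem norm_sq_dtn_coeff_le {a c : ℝ} {b : ℂ} (hca : c < a ^ 2)
    (hb : b = if a ^ 2 ≤ c then (Real.sqrt (c - a ^ 2) : ℂ)
      else Complex.I * (Real.sqrt (a ^ 2 - c) : ℂ)) (hc : 0 ≤ c) :
    ‖b‖ ^ 2 ≤ 1 + a ^ 2 := by
  rw [hb, if_neg hca.not_ge, norm_mul, Complex.norm_I, one_mul, Complex.norm_real,
    Real.norm_eq_abs, sq_abs, Real.sq_sqrt (by linarith)]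
  linarith

/-- Proposition 2.7 (squared form): algebraic decay of the DtN truncation error.
If `M ≥ (L/2π)(k√ε + |α₀|)`, `t > 0`, and `L Σ (1+α_n²)^{s+t}|φ_n|² < ∞`, then
`L Σ_{|n|>M} (1+α_n²)^{s−1}|β_n|²|φ_n|² ≤ (2πM/L − |α₀|)^{−2t} · L Σ (1+α_n²)^{s+t}|φ_n|²`. -/
theorem dtn_truncation_error_decay
    (L α₀ k ε : ℝ) (hL : 0 < L) (hk : 0 < k) (hε : 0 < ε)
    (α : ℤ → ℝ) (hα : ∀ n : ℤ, α n = α₀ + 2 * Real.pi * n / L)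
    (β : ℤ → ℂ)
    (hβ : ∀ n : ℤ, β n =
      if (α n) ^ 2 ≤ k ^ 2 * ε then (Real.sqrt (k ^ 2 * ε - (α n) ^ 2) : ℂ)
      else Complex.I * (Real.sqrt ((α n) ^ 2 - k ^ 2 * ε) : ℂ))
    (s t : ℝ) (ht : 0 < t)
    (M : ℕ) (hM : (L / (2 * Real.pi)) * (k * Real.sqrt ε + |α₀|) ≤ M)
    (φ : ℤ → ℂ)
    (hφ : Summable (fun n : ℤ => (1 + (α n) ^ 2) ^ (s + t) * ‖φ n‖ ^ 2)) :
    L * ∑' n : ℤ,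
        (if (M : ℤ) < |n| then (1 + (α n) ^ 2) ^ (s - 1) * ‖β n‖ ^ 2 * ‖φ n‖ ^ 2 else 0) ≤
      (2 * Real.pi * M / L - |α₀|) ^ (-(2 * t)) *
        (L * ∑' n : ℤ, (1 + (α n) ^ 2) ^ (s + t) * ‖φ n‖ ^ 2) := by
  have hpi := Real.pi_pos
  set A : ℝ := 2 * Real.pi * M / L - |α₀| with hA
  have hAk : k * Real.sqrt ε ≤ A := by
    rw [div_mul_eq_mul_div, div_le_iff₀ (by positivity)] at hM
    rw [hA, le_sub_iff_add_le, le_div_iff₀ hL]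
    linarith
  have hkε : 0 < k * Real.sqrt ε := mul_pos hk (Real.sqrt_pos.2 hε)
  have hA0 : 0 < A := hkε.trans_le hAk
  have hfreq : ∀ n : ℤ, (M : ℤ) < |n| → A < |α n| := by
    intro n hn
    have hn' : (M : ℝ) < |(n : ℝ)| := by exact_mod_cast hn
    have h1 : 2 * Real.pi * M / L < |2 * Real.pi * n / L| := by
      rw [abs_div, abs_mul, abs_of_pos hL, abs_of_pos (by positivity : 0 < 2 * Real.pi)]
      gcongr
    have h2 : |2 * Real.pi * n / L| - |α₀| ≤ |α n| := by
      rw [hα n, add_comm]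
      simpa using abs_sub_abs_le_abs_sub (2 * Real.pi * n / L) (-α₀)
    linarith
  have hterm : ∀ n : ℤ,
      (if (M : ℤ) < |n| then (1 + (α n) ^ 2) ^ (s - 1) * ‖β n‖ ^ 2 * ‖φ n‖ ^ 2 else 0) ≤
        A ^ (-(2 * t)) * ((1 + (α n) ^ 2) ^ (s + t) * ‖φ n‖ ^ 2) := by
    intro n
    split_ifs with hn
    · have hαA : A ^ 2 < (α n) ^ 2 := by
        rw [← sq_abs (α n)]
        exact pow_lt_pow_left₀ (hfreq n hn) hA0.le two_ne_zero
      have hcut : k ^ 2 * ε < (α n) ^ 2 := by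
        have h := pow_le_pow_left₀ hkε.le hAk 2
        rw [mul_pow, Real.sq_sqrt hε.le] at h
        exact h.trans_lt hαA
      have hw : 0 < 1 + (α n) ^ 2 := by positivity
      rw [← mul_assoc]
      refine mul_le_mul_of_nonneg_right ?_ (sq_nonneg _)
      calc (1 + (α n) ^ 2) ^ (s - 1) * ‖β n‖ ^ 2
          ≤ (1 + (α n) ^ 2) ^ (s - 1) * (1 + (α n) ^ 2) := by
            gcongr
            exact norm_sq_dtn_coeff_le hcut (hβ n) (by positivity)
        _ = (1 + (α n) ^ 2) ^ (-t) * (1 + (α n) ^ 2) ^ (s + t) := by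
            rw [← Real.rpow_add_one hw.ne', ← Real.rpow_add hw]
            ring_nf
        _ ≤ A ^ (-(2 * t)) * (1 + (α n) ^ 2) ^ (s + t) := by
            have h : A ^ (-(2 * t)) = (A ^ 2) ^ (-t) := by
              rw [← Real.rpow_natCast_mul hA0.le]
              push_cast
              ring_nf
            rw [h]
            refine mul_le_mul_of_nonneg_right ?_ (Real.rpow_nonneg hw.le _)
            exact Real.rpow_le_rpow_of_nonpos (by positivity) (by linarith) (by linarith)
    · positivity
  have hnonneg : ∀ n : ℤ, 0 ≤
      (if (M : ℤ) < |n| then (1 + (α n) ^ 2) ^ (s - 1) * ‖β n‖ ^ 2 * ‖φ n‖ ^ 2 else 0) := by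
    intro n
    split_ifs <;> positivity
  have hsum := hφ.mul_left (A ^ (-(2 * t)))
  have hle := (Summable.of_nonneg_of_le hnonneg hterm hsum).tsum_le_tsum hterm hsum
  rw [tsum_mul_left] at hle
  rw [mul_left_comm]
  exact mul_le_mul_of_nonneg_left hle hL.le
end

section
/- For every s ∈ ℝ and every sequence φ : ℤ → ℂ, one has Σ_{n∈ℤ} (1+α_n²)^{s−1} |β_n|² |φ_n|² ≤ max{1, k²ε} · Σ_{n∈ℤ} (1+α_n²)^{s} |φ_n|². In particular, if the right-hand side is finite so is the left-hand side, i.e., the DtN operator T maps H^s_{α₀} boundedly into H^{s−1}_{α₀}. -/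
/-- The squared modulus of a Dirichlet-to-Neumann coefficient is `|κ - a²|`. -/
lemma norm_sq_dtn_coeff (a κ : ℝ) :
    ‖(if a ^ 2 ≤ κ then (Real.sqrt (κ - a ^ 2) : ℂ)
      else Complex.I * (Real.sqrt (a ^ 2 - κ) : ℂ))‖ ^ 2 = |κ - a ^ 2| := by
  split_ifs with h
  · rw [Complex.norm_real, Real.norm_eq_abs, sq_abs, Real.sq_sqrt (sub_nonneg.2 h),
      abs_of_nonneg (sub_nonneg.2 h)]
  · have h' : 0 ≤ a ^ 2 - κ := by linarith
    rw [norm_mul, Complex.norm_I, one_mul, Complex.norm_real, Real.norm_eq_abs, sq_abs,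
      Real.sq_sqrt h', abs_sub_comm, abs_of_nonneg h']

lemma abs_sub_sq_le_max_mul (a : ℝ) {κ : ℝ} (hκ : 0 ≤ κ) :
    |κ - a ^ 2| ≤ max 1 κ * (1 + a ^ 2) := by
  have h₁ := le_max_left 1 κ
  have h₂ := le_max_right 1 κ
  have ha := sq_nonneg a
  rw [abs_le]
  constructor <;> nlinarith [mul_le_mul_of_nonneg_right h₁ ha]

/-- The square of an arithmetic progression with nonzero step tends to infinity along `ℤ`. -/
lemma tendsto_sq_add_mul_intCast_cofinite (a : ℝ) {c : ℝ} (hc : c ≠ 0) :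
    Filter.Tendsto (fun n : ℤ => (a + c * n) ^ 2) Filter.cofinite Filter.atTop := by
  have h : Filter.Tendsto (fun n : ℤ => a + c * n) Filter.cofinite (Filter.cocompact ℝ) :=
    (((Homeomorph.mulLeft₀ c hc).trans
      (Homeomorph.addLeft a)).isClosedEmbedding.tendsto_cocompact).comp Int.tendsto_coe_cofinite
  have h' := (Filter.tendsto_pow_atTop two_ne_zero).comp (tendsto_norm_cocompact_atTop.comp h)
  simpa [Function.comp_def, sq_abs] using h'

/-- Lemma 2.3 and its extension: continuity of the DtN operator `T : H^s → H^{s−1}`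
in Fourier-coefficient form. For every `s ∈ ℝ` and every `φ : ℤ → ℂ`,
`Σ (1+α_n²)^{s−1}|β_n|²|φ_n|² ≤ max{1, k²ε} Σ (1+α_n²)^s |φ_n|²`, and summability of the
right-hand side implies summability of the left-hand side. -/
theorem dtn_operator_continuity
    (L α₀ k ε : ℝ) (hL : 0 < L) (hk : 0 < k) (hε : 0 < ε)
    (α : ℤ → ℝ) (hα : ∀ n : ℤ, α n = α₀ + 2 * Real.pi * n / L)
    (β : ℤ → ℂ)
    (hβ : ∀ n : ℤ, β n =
      if (α n) ^ 2 ≤ k ^ 2 * ε then (Real.sqrt (k ^ 2 * ε - (α n) ^ 2) : ℂ)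
      else Complex.I * (Real.sqrt ((α n) ^ 2 - k ^ 2 * ε) : ℂ))
    (s : ℝ) (φ : ℤ → ℂ) :
    (∑' n : ℤ, (1 + (α n) ^ 2) ^ (s - 1) * ‖β n‖ ^ 2 * ‖φ n‖ ^ 2) ≤
      max 1 (k ^ 2 * ε) * ∑' n : ℤ, (1 + (α n) ^ 2) ^ s * ‖φ n‖ ^ 2 ∧
    (Summable (fun n : ℤ => (1 + (α n) ^ 2) ^ s * ‖φ n‖ ^ 2) →
      Summable (fun n : ℤ => (1 + (α n) ^ 2) ^ (s - 1) * ‖β n‖ ^ 2 * ‖φ n‖ ^ 2)) := by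
  have hκ : 0 ≤ k ^ 2 * ε := by positivity
  have hβ_sq (n : ℤ) : ‖β n‖ ^ 2 = |k ^ 2 * ε - (α n) ^ 2| := by
    rw [hβ n]
    exact norm_sq_dtn_coeff (α n) (k ^ 2 * ε)
  have hpos (n : ℤ) : 0 < 1 + (α n) ^ 2 := by positivity
  have hpow (n : ℤ) : (1 + (α n) ^ 2) ^ s = (1 + (α n) ^ 2) ^ (s - 1) * (1 + (α n) ^ 2) := by
    rw [← Real.rpow_add_one (hpos n).ne', sub_add_cancel]
  have hle (n : ℤ) : (1 + (α n) ^ 2) ^ (s - 1) * ‖β n‖ ^ 2 * ‖φ n‖ ^ 2 ≤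
      max 1 (k ^ 2 * ε) * ((1 + (α n) ^ 2) ^ s * ‖φ n‖ ^ 2) := by
    calc (1 + (α n) ^ 2) ^ (s - 1) * ‖β n‖ ^ 2 * ‖φ n‖ ^ 2
        ≤ (1 + (α n) ^ 2) ^ (s - 1) * (max 1 (k ^ 2 * ε) * (1 + (α n) ^ 2)) * ‖φ n‖ ^ 2 := by
          rw [hβ_sq]
          gcongr
          exact abs_sub_sq_le_max_mul (α n) hκ
      _ = max 1 (k ^ 2 * ε) * ((1 + (α n) ^ 2) ^ s * ‖φ n‖ ^ 2) := by
          rw [hpow]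
          ring
  have hsum (h : Summable (fun n : ℤ => (1 + (α n) ^ 2) ^ s * ‖φ n‖ ^ 2)) :
      Summable (fun n : ℤ => (1 + (α n) ^ 2) ^ (s - 1) * ‖β n‖ ^ 2 * ‖φ n‖ ^ 2) :=
    (h.mul_left _).of_nonneg_of_le (fun n => by positivity) hle
  refine ⟨?_, hsum⟩
  by_cases h : Summable (fun n : ℤ => (1 + (α n) ^ 2) ^ s * ‖φ n‖ ^ 2)
  · rw [← tsum_mul_left]
    exact (hsum h).tsum_le_tsum hle (h.mul_left _)
  -- Away from finitely many modes `1 + α_n² ≤ 2 |β_n|²`, so both series diverge together.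
  have hlarge : ∀ᶠ n in Filter.cofinite, 2 * (k ^ 2 * ε) + 1 ≤ (α n) ^ 2 := by
    have hα' : α = fun n : ℤ => α₀ + 2 * Real.pi / L * n := by
      funext n
      rw [hα n]
      ring
    have hc : 2 * Real.pi / L ≠ 0 := by positivity
    rw [hα']
    exact (tendsto_sq_add_mul_intCast_cofinite α₀ hc).eventually_ge_atTop _
  have hnot : ¬ Summable (fun n : ℤ => (1 + (α n) ^ 2) ^ (s - 1) * ‖β n‖ ^ 2 * ‖φ n‖ ^ 2) := by
    refine fun h' => h ((h'.mul_left 2).of_norm_bounded_eventually ?_)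
    filter_upwards [hlarge] with n hn
    rw [Real.norm_of_nonneg (by positivity)]
    calc (1 + (α n) ^ 2) ^ s * ‖φ n‖ ^ 2
        = (1 + (α n) ^ 2) ^ (s - 1) * (1 + (α n) ^ 2) * ‖φ n‖ ^ 2 := by rw [hpow]
      _ ≤ (1 + (α n) ^ 2) ^ (s - 1) * (2 * ‖β n‖ ^ 2) * ‖φ n‖ ^ 2 := by
          gcongr
          rw [hβ_sq]
          linarith [neg_le_abs (k ^ 2 * ε - (α n) ^ 2)]
      _ = 2 * ((1 + (α n) ^ 2) ^ (s - 1) * ‖β n‖ ^ 2 * ‖φ n‖ ^ 2) := by ring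
  rw [tsum_eq_zero_of_not_summable h, tsum_eq_zero_of_not_summable hnot, mul_zero]
end

section
/- Let ε ∈ ℂ with Im ε > 0, let k > 0, and for each n ∈ ℤ let β_n be the unique complex number with β_n² = k²ε − α_n² and Im β_n > 0. Then Re β_n > 0 for all n, and for every sequence w : ℤ → ℂ with Σ_{n∈ℤ} (1+α_n²)^{1/2} |w_n|² < ∞ the series L·Σ_{n∈ℤ} i·β_n·|w_n|² converges absolutely and its imaginary part equals L·Σ_{n∈ℤ} Re(β_n)·|w_n|², which is ≥ 0. -/
/-- A complex number with positive imaginary part whose square has positive imaginary part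
has positive real part. -/
theorem Complex.re_pos_of_im_sq_pos {z : ℂ} (hz : 0 < z.im) (h : 0 < (z ^ 2).im) :
    0 < z.re := by
  have h2 : (z ^ 2).im = 2 * z.re * z.im := by
    rw [sq, Complex.mul_im]
    ring
  rw [h2] at h
  linarith [pos_of_mul_pos_left h hz.le]

/-- A square root of `c - a ^ 2` is bounded by a multiple of `√(1 + a ^ 2)`. -/
theorem Complex.norm_le_sqrt_of_sq_eq_sub {z c : ℂ} {a : ℝ} (h : z ^ 2 = c - (a : ℂ) ^ 2) :
    ‖z‖ ≤ √(1 + ‖c‖) * √(1 + a ^ 2) := by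
  rw [← Real.sqrt_mul (by positivity)]
  apply Real.le_sqrt_of_sq_le
  have h1 : ‖z‖ ^ 2 ≤ ‖c‖ + a ^ 2 := by
    rw [← norm_pow, h]
    refine (norm_sub_le _ _).trans_eq ?_
    simp
  nlinarith [mul_nonneg (norm_nonneg c) (sq_nonneg a)]


/-- Lossy-medium case of Lemma 2.5: with `Im ε > 0`, `k > 0`, `α n = α₀ + 2πn/L`, and
`β n` the square root of `k²ε − α_n²` with positive imaginary part, each `β n` has positive
real part, and for every `w` with `Σ (1+α_n²)^{1/2}|w_n|² < ∞` the series
`L Σ i β_n |w_n|²` converges absolutely, with imaginary part `L Σ Re(β_n)|w_n|² ≥ 0`. -/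
theorem dtn_form_imaginary_part_lossy
    (L α₀ k : ℝ) (hL : 0 < L) (hk : 0 < k)
    (ε : ℂ) (hε : 0 < ε.im)
    (α : ℤ → ℝ) (hα : ∀ n : ℤ, α n = α₀ + 2 * Real.pi * n / L)
    (β : ℤ → ℂ)
    (hβ : ∀ n : ℤ, (β n) ^ 2 = (k : ℂ) ^ 2 * ε - ((α n : ℝ) : ℂ) ^ 2 ∧ 0 < (β n).im)
    (w : ℤ → ℂ)
    (hw : Summable (fun n : ℤ => Real.sqrt (1 + (α n) ^ 2) * ‖w n‖ ^ 2)) :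
    (∀ n : ℤ, 0 < (β n).re) ∧
    Summable (fun n : ℤ => ‖(L : ℂ) * (Complex.I * β n * (‖w n‖ : ℂ) ^ 2)‖) ∧
    (∑' n : ℤ, (L : ℂ) * (Complex.I * β n * (‖w n‖ : ℂ) ^ 2)).im =
      L * ∑' n : ℤ, (β n).re * ‖w n‖ ^ 2 ∧
    0 ≤ L * ∑' n : ℤ, (β n).re * ‖w n‖ ^ 2 := by
  have hre : ∀ n : ℤ, 0 < (β n).re := fun n => by
    refine Complex.re_pos_of_im_sq_pos (hβ n).2 ?_
    have him : ((k : ℂ) ^ 2 * ε - ((α n : ℝ) : ℂ) ^ 2).im = k ^ 2 * ε.im := by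
      rw [← Complex.ofReal_pow, ← Complex.ofReal_pow, Complex.sub_im, Complex.im_ofReal_mul,
        Complex.ofReal_im, sub_zero]
    rw [(hβ n).1, him]
    positivity
  have hsum : Summable (fun n : ℤ => ‖(L : ℂ) * (Complex.I * β n * (‖w n‖ : ℂ) ^ 2)‖) := by
    refine Summable.of_nonneg_of_le (fun _ => norm_nonneg _) (fun n => ?_)
      (hw.mul_left (L * √(1 + ‖(k : ℂ) ^ 2 * ε‖)))
    have hb := Complex.norm_le_sqrt_of_sq_eq_sub (hβ n).1
    calc ‖(L : ℂ) * (Complex.I * β n * (‖w n‖ : ℂ) ^ 2)‖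
        = L * (‖β n‖ * ‖w n‖ ^ 2) := by simp [abs_of_pos hL]
      _ ≤ L * (√(1 + ‖(k : ℂ) ^ 2 * ε‖) * √(1 + α n ^ 2) * ‖w n‖ ^ 2) := by gcongr
      _ = L * √(1 + ‖(k : ℂ) ^ 2 * ε‖) * (√(1 + α n ^ 2) * ‖w n‖ ^ 2) := by ring
  refine ⟨hre, hsum, ?_, ?_⟩
  · rw [Complex.im_tsum hsum.of_norm, ← tsum_mul_left]
    refine tsum_congr fun n => ?_
    rw [← Complex.ofReal_pow, Complex.im_ofReal_mul, Complex.im_mul_ofReal, Complex.I_mul_im]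
  · exact mul_nonneg hL.le (tsum_nonneg fun n => mul_nonneg (hre n).le (sq_nonneg _))
end

section
/- Let L, H > 0, ε > 0, k > 0, α₀ ∈ ℝ, and let u : ℝ² → ℂ be twice continuously differentiable on an open neighborhood of the closed rectangle [0,L] × [−H,H], satisfying the Helmholtz equation ∂²u/∂x₁² + ∂²u/∂x₂² + k²ε·u = 0 on the rectangle, and the quasi-periodicity conditions u(L,x₂) = e^{iα₀L}·u(0,x₂) and (∂u/∂x₁)(L,x₂) = e^{iα₀L}·(∂u/∂x₁)(0,x₂) for all x₂ ∈ [−H,H]. Then ∫∫_{(0,L)×(−H,H)} (|∇u|² − k²ε|u|²) dx = 2·∫∫_{(0,L)×(−H,H)} |∂u/∂x₂|² dx + H·∫_0^L [ (|∂u/∂x₁|² − |∂u/∂x₂|² − k²ε|u|²)(x₁, H) + (|∂u/∂x₁|² − |∂u/∂x₂|² − k²ε|u|²)(x₁, −H) ] dx₁. -/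
open MeasureTheory Set

/-- The iterated interval integral of a difference of two functions continuous on a rectangle. -/
lemma intervalIntegral_intervalIntegral_sub {f g : ℝ → ℝ → ℝ} {a b c d : ℝ}
    (hab : a ≤ b) (hcd : c ≤ d)
    (hf : ContinuousOn (fun p : ℝ × ℝ => f p.1 p.2) (Icc a b ×ˢ Icc c d))
    (hg : ContinuousOn (fun p : ℝ × ℝ => g p.1 p.2) (Icc a b ×ˢ Icc c d)) :
    (∫ x in a..b, ∫ y in c..d, (f x y - g x y)) =
      (∫ x in a..b, ∫ y in c..d, f x y) - ∫ x in a..b, ∫ y in c..d, g x y := by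
  have slice : ∀ {h : ℝ → ℝ → ℝ},
      ContinuousOn (fun p : ℝ × ℝ => h p.1 p.2) (Icc a b ×ˢ Icc c d) →
      ∀ x ∈ Icc a b, IntervalIntegrable (h x) volume c d := by
    intro h hh x hx
    refine ContinuousOn.intervalIntegrable_of_Icc hcd ?_
    exact hh.comp (f := fun y => (x, y)) (by fun_prop) (fun y hy => ⟨hx, hy⟩)
  have outer : ∀ {h : ℝ → ℝ → ℝ},
      ContinuousOn (fun p : ℝ × ℝ => h p.1 p.2) (Icc a b ×ˢ Icc c d) →
      IntervalIntegrable (fun x => ∫ y in c..d, h x y) volume a b := by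
    intro h hh
    have hi : IntegrableOn (fun p : ℝ × ℝ => h p.1 p.2) (Ioc a b ×ˢ Ioc c d) :=
      (hh.integrableOn_compact (isCompact_Icc.prod isCompact_Icc)).mono_set
        (prod_mono Ioc_subset_Icc_self Ioc_subset_Icc_self)
    rw [IntegrableOn, Measure.volume_eq_prod, ← Measure.prod_restrict] at hi
    rw [intervalIntegrable_iff_integrableOn_Ioc_of_le hab]
    simp only [intervalIntegral.integral_of_le hcd]
    exact hi.integral_prod_left
  rw [← intervalIntegral.integral_sub (outer hf) (outer hg)]
  refine intervalIntegral.integral_congr fun x hx => ?_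
  rw [uIcc_of_le hab] at hx
  exact intervalIntegral.integral_sub (slice hf x hx) (slice hg x hx)

/-- Rotating both arguments by the same phase preserves the real inner product on `ℂ`. -/
lemma Complex.real_inner_mul_mul_of_norm_eq_one {c : ℂ} (hc : ‖c‖ = 1) (z w : ℂ) :
    inner ℝ (c * z) (c * w) = inner ℝ z w := by
  have h : c.re * c.re + c.im * c.im = 1 := by
    rw [← Complex.normSq_apply, Complex.normSq_eq_norm_sq, hc, one_pow]
  simp only [Complex.inner, Complex.mul_re, Complex.mul_im, Complex.conj_re, Complex.conj_im]
  linear_combination (z.re * w.re + z.im * w.im) * h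

lemma hasDerivAt_fst_slice {v : ℝ × ℝ → ℂ} {x y : ℝ} (h : DifferentiableAt ℝ v (x, y)) :
    HasDerivAt (fun t => v (t, y)) (fderiv ℝ v (x, y) (1, 0)) x :=
  h.hasFDerivAt.comp_hasDerivAt x ((hasDerivAt_id x).prodMk (hasDerivAt_const x y))

lemma hasDerivAt_snd_slice {v : ℝ × ℝ → ℂ} {x y : ℝ} (h : DifferentiableAt ℝ v (x, y)) :
    HasDerivAt (fun t => v (x, t)) (fderiv ℝ v (x, y) (0, 1)) y :=
  h.hasFDerivAt.comp_hasDerivAt y ((hasDerivAt_const y x).prodMk (hasDerivAt_id y))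

/-- The divergence of the Rellich vector field
`(2 x₂ Re (conj (∂₂v) ∂₁v), x₂ (|∂₂v|² - |∂₁v|² + κ |v|²))` at a point where `Δv + κ v = 0`. -/
lemma rellich_divergence {v : ℝ × ℝ → ℂ} {p : ℝ × ℝ} {κ : ℝ} (hv : ContDiffAt ℝ 2 v p)
    (hΔ : fderiv ℝ (fderiv ℝ v) p (1, 0) (1, 0) + fderiv ℝ (fderiv ℝ v) p (0, 1) (0, 1) +
      (κ : ℂ) * v p = 0) :
    fderiv ℝ (fun q : ℝ × ℝ =>
        2 * q.2 * inner ℝ (fderiv ℝ v q (0, 1)) (fderiv ℝ v q (1, 0))) p (1, 0) +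
      fderiv ℝ (fun q : ℝ × ℝ => q.2 * (‖fderiv ℝ v q (0, 1)‖ ^ 2 - ‖fderiv ℝ v q (1, 0)‖ ^ 2
        + κ * ‖v q‖ ^ 2)) p (0, 1) =
    ‖fderiv ℝ v p (0, 1)‖ ^ 2 - ‖fderiv ℝ v p (1, 0)‖ ^ 2 + κ * ‖v p‖ ^ 2 := by
  have hsymm : fderiv ℝ (fderiv ℝ v) p (1, 0) (0, 1) = fderiv ℝ (fderiv ℝ v) p (0, 1) (1, 0) :=
    (hv.isSymmSndFDerivAt (by simp)) _ _
  have hv1 : HasFDerivAt v (fderiv ℝ v p) p := (hv.differentiableAt (by norm_num)).hasFDerivAt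
  have hd : HasFDerivAt (fderiv ℝ v) (fderiv ℝ (fderiv ℝ v) p) p :=
    ((hv.fderiv_right (m := 1) (by norm_num)).differentiableAt (by norm_num)).hasFDerivAt
  have ha := hd.clm_apply (hasFDerivAt_const ((1, 0) : ℝ × ℝ) p)
  have hb := hd.clm_apply (hasFDerivAt_const ((0, 1) : ℝ × ℝ) p)
  have hs : HasFDerivAt (fun q : ℝ × ℝ => q.2) (ContinuousLinearMap.snd ℝ ℝ ℝ) p := hasFDerivAt_snd
  have hF := (hs.const_mul 2).mul (hb.inner ℝ ha)
  have hG := hs.mul ((hb.norm_sq.sub ha.norm_sq).add (hv1.norm_sq.const_mul κ))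
  have hre := congrArg Complex.re hΔ
  have him := congrArg Complex.im hΔ
  erw [hF.fderiv, hG.fderiv]
  simp [hsymm, Complex.inner] at hre him ⊢
  generalize fderiv ℝ (fderiv ℝ v) p (1, 0) (1, 0) = v11 at *
  generalize fderiv ℝ (fderiv ℝ v) p (0, 1) (0, 1) = v22 at *
  generalize fderiv ℝ (fderiv ℝ v) p (0, 1) (1, 0) = v12 at *
  generalize fderiv ℝ v p (1, 0) = v1 at *
  generalize fderiv ℝ v p (0, 1) = v2 at *
  linear_combination 2 * p.2 * v2.re * hre + 2 * p.2 * v2.im * him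

/-- Rellich-multiplier identity (3.5) in the smooth, constant-coefficient, obstacle-free
configuration: for a quasi-periodic `C²` solution of the Helmholtz equation on the
rectangle `[0,L]×[−H,H]`,
`∫∫ (|∇u|² − k²ε|u|²) = 2 ∫∫ |∂₂u|² + H ∫₀ᴸ (|∂₁u|² − |∂₂u|² − k²ε|u|²)(x₁, ±H) dx₁`. -/
theorem rellich_identity_rectangle
    (L H k ε α₀ : ℝ) (hL : 0 < L) (hH : 0 < H) (hk : 0 < k) (hε : 0 < ε)
    (u : ℝ → ℝ → ℂ)
    (U : Set (ℝ × ℝ)) (hUopen : IsOpen U)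
    (hUrect : Set.Icc (0 : ℝ) L ×ˢ Set.Icc (-H) H ⊆ U)
    (hu : ContDiffOn ℝ 2 (fun p : ℝ × ℝ => u p.1 p.2) U)
    (hHelm : ∀ x₁ x₂ : ℝ, (x₁, x₂) ∈ Set.Icc (0 : ℝ) L ×ˢ Set.Icc (-H) H →
      deriv (deriv (fun t => u t x₂)) x₁ + deriv (deriv (fun t => u x₁ t)) x₂ +
        ((k ^ 2 * ε : ℝ) : ℂ) * u x₁ x₂ = 0)
    (hqp : ∀ x₂ ∈ Set.Icc (-H) H,
      u L x₂ = Complex.exp (Complex.I * α₀ * L) * u 0 x₂ ∧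
      deriv (fun t => u t x₂) L = Complex.exp (Complex.I * α₀ * L) * deriv (fun t => u t x₂) 0) :
    (∫ x₁ in (0 : ℝ)..L, ∫ x₂ in (-H)..H,
        (‖deriv (fun t => u t x₂) x₁‖ ^ 2 + ‖deriv (fun t => u x₁ t) x₂‖ ^ 2
          - k ^ 2 * ε * ‖u x₁ x₂‖ ^ 2)) =
      2 * (∫ x₁ in (0 : ℝ)..L, ∫ x₂ in (-H)..H, ‖deriv (fun t => u x₁ t) x₂‖ ^ 2) +
      H * ∫ x₁ in (0 : ℝ)..L,
        ((‖deriv (fun t => u t H) x₁‖ ^ 2 - ‖deriv (fun t => u x₁ t) H‖ ^ 2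
            - k ^ 2 * ε * ‖u x₁ H‖ ^ 2) +
         (‖deriv (fun t => u t (-H)) x₁‖ ^ 2 - ‖deriv (fun t => u x₁ t) (-H)‖ ^ 2
            - k ^ 2 * ε * ‖u x₁ (-H)‖ ^ 2)) := by
  set κ : ℝ := k ^ 2 * ε
  set v : ℝ × ℝ → ℂ := fun p => u p.1 p.2 with hv
  set R : Set (ℝ × ℝ) := Icc (0 : ℝ) L ×ˢ Icc (-H) H
  have hHH : -H ≤ H := by linarith
  have hcd : ∀ p ∈ U, ContDiffAt ℝ 2 v p := fun p hp => hu.contDiffAt (hUopen.mem_nhds hp)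
  have hdiff : ∀ p ∈ U, DifferentiableAt ℝ v p :=
    fun p hp => (hcd p hp).differentiableAt (by norm_num)
  have hDcd : ContDiffOn ℝ 1 (fderiv ℝ v) U := hu.fderiv_of_isOpen hUopen (by norm_num)
  have hDdiff : ∀ p ∈ U, DifferentiableAt ℝ (fderiv ℝ v) p := fun p hp =>
    (hDcd.contDiffAt (hUopen.mem_nhds hp)).differentiableAt (by norm_num)
  have d1 : ∀ x y, (x, y) ∈ U → deriv (fun t => u t y) x = fderiv ℝ v (x, y) (1, 0) :=
    fun x y h => (hasDerivAt_fst_slice (hdiff _ h)).deriv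
  have d2 : ∀ x y, (x, y) ∈ U → deriv (fun t => u x t) y = fderiv ℝ v (x, y) (0, 1) :=
    fun x y h => (hasDerivAt_snd_slice (hdiff _ h)).deriv
  have hΔ : ∀ p ∈ R, fderiv ℝ (fderiv ℝ v) p (1, 0) (1, 0) +
      fderiv ℝ (fderiv ℝ v) p (0, 1) (0, 1) + (κ : ℂ) * v p = 0 := by
    rintro ⟨x, y⟩ hp
    have hpU := hUrect hp
    have e1 : deriv (deriv (fun t => u t y)) x = fderiv ℝ (fderiv ℝ v) (x, y) (1, 0) (1, 0) := by
      have hev : deriv (fun t => u t y) =ᶠ[nhds x] fun t => fderiv ℝ v (t, y) (1, 0) := by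
        filter_upwards [(hUopen.preimage (by fun_prop : Continuous fun t : ℝ => (t, y))).mem_nhds
          hpU] with t ht using d1 t y ht
      rw [hev.deriv_eq, (hasDerivAt_fst_slice (v := fun q => fderiv ℝ v q (1, 0))
        ((hDdiff _ hpU).clm_apply (differentiableAt_const _))).deriv,
        fderiv_clm_apply (hDdiff _ hpU) (differentiableAt_const _)]
      simp
    have e2 : deriv (deriv (fun t => u x t)) y = fderiv ℝ (fderiv ℝ v) (x, y) (0, 1) (0, 1) := by
      have hev : deriv (fun t => u x t) =ᶠ[nhds y] fun t => fderiv ℝ v (x, t) (0, 1) := by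
        filter_upwards [(hUopen.preimage (by fun_prop : Continuous fun t : ℝ => (x, t))).mem_nhds
          hpU] with t ht using d2 x t ht
      rw [hev.deriv_eq, (hasDerivAt_snd_slice (v := fun q => fderiv ℝ v q (0, 1))
        ((hDdiff _ hpU).clm_apply (differentiableAt_const _))).deriv,
        fderiv_clm_apply (hDdiff _ hpU) (differentiableAt_const _)]
      simp
    rw [← e1, ← e2]
    exact hHelm x y hp
  have hv1 : ContDiffOn ℝ 1 v U := hu.of_le (by norm_num)
  have ha : ContDiffOn ℝ 1 (fun p => fderiv ℝ v p (1, 0)) U := hDcd.clm_apply contDiffOn_const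
  have hb : ContDiffOn ℝ 1 (fun p => fderiv ℝ v p (0, 1)) U := hDcd.clm_apply contDiffOn_const
  set F : ℝ × ℝ → ℝ := fun q =>
    2 * q.2 * inner ℝ (fderiv ℝ v q (0, 1)) (fderiv ℝ v q (1, 0)) with hF
  set W : ℝ × ℝ → ℝ := fun q =>
    ‖fderiv ℝ v q (0, 1)‖ ^ 2 - ‖fderiv ℝ v q (1, 0)‖ ^ 2 + κ * ‖v q‖ ^ 2 with hW
  set G : ℝ × ℝ → ℝ := fun q => q.2 * W q with hG
  have hFcd : ContDiffOn ℝ 1 F U :=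
    (contDiffOn_const.mul contDiff_snd.contDiffOn).mul (hb.inner ℝ ha)
  have hWcd : ContDiffOn ℝ 1 W U :=
    ((hb.norm_sq ℝ).sub (ha.norm_sq ℝ)).add (contDiffOn_const.mul (hv1.norm_sq ℝ))
  have hGcd : ContDiffOn ℝ 1 G U := contDiff_snd.contDiffOn.mul hWcd
  have hdiv : ∀ p ∈ R, fderiv ℝ F p (1, 0) + fderiv ℝ G p (0, 1) = W p := fun p hp =>
    rellich_divergence (hcd p (hUrect hp)) (hΔ p hp)
  have hRR : uIcc 0 L ×ˢ uIcc (-H) H = R := by rw [uIcc_of_le hL.le, uIcc_of_le hHH]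
  have hIoo : Ioo (min 0 L) (max 0 L) ×ˢ Ioo (min (-H) H) (max (-H) H) ⊆ U := by
    rw [min_eq_left hL.le, max_eq_right hL.le, min_eq_left hHH, max_eq_right hHH]
    exact (prod_mono Ioo_subset_Icc_self Ioo_subset_Icc_self).trans hUrect
  have hWR : ContinuousOn W R := hWcd.continuousOn.mono hUrect
  have hdivthm := integral2_divergence_prod_of_hasFDerivAt F G (fderiv ℝ F) (fderiv ℝ G) 0 (-H) L H
    (hRR ▸ hFcd.continuousOn.mono hUrect) (hRR ▸ hGcd.continuousOn.mono hUrect)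
    (fun p hp => ((hFcd.contDiffAt (hUopen.mem_nhds (hIoo hp))).differentiableAt
      (by norm_num)).hasFDerivAt)
    (fun p hp => ((hGcd.contDiffAt (hUopen.mem_nhds (hIoo hp))).differentiableAt
      (by norm_num)).hasFDerivAt)
    (by
      rw [hRR]
      exact (hWR.congr hdiv).integrableOn_compact (isCompact_Icc.prod isCompact_Icc))
  have hmem : ∀ {x y}, x ∈ uIcc 0 L → y ∈ uIcc (-H) H → (x, y) ∈ R := by
    intro x y hx hy
    rw [← hRR]
    exact ⟨hx, hy⟩
  have hsides : ∫ y in (-H)..H, F (L, y) = ∫ y in (-H)..H, F (0, y) := by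
    refine intervalIntegral.integral_congr_Ioo_of_le hHH fun y hy => ?_
    have hyI := Ioo_subset_Icc_self hy
    have hU0 : ((0 : ℝ), y) ∈ U := hUrect ⟨left_mem_Icc.2 hL.le, hyI⟩
    have hUL : (L, y) ∈ U := hUrect ⟨right_mem_Icc.2 hL.le, hyI⟩
    have hnorm : ‖Complex.exp (Complex.I * α₀ * L)‖ = 1 := by
      have := Complex.norm_exp_ofReal_mul_I (α₀ * L)
      rwa [show ((α₀ * L : ℝ) : ℂ) * Complex.I = Complex.I * α₀ * L by push_cast; ring] at this
    have h1 := (hqp y hyI).2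
    rw [d1 _ _ hUL, d1 _ _ hU0] at h1
    have h2 : fderiv ℝ v (L, y) (0, 1) =
        Complex.exp (Complex.I * α₀ * L) * fderiv ℝ v (0, y) (0, 1) := by
      have hev : (fun t => u L t) =ᶠ[nhds y]
          fun t => Complex.exp (Complex.I * α₀ * L) * u 0 t := by
        filter_upwards [Icc_mem_nhds hy.1 hy.2] with t ht using (hqp t ht).1
      rw [← d2 _ _ hUL, hev.deriv_eq]
      exact ((hasDerivAt_snd_slice (hdiff _ hU0)).const_mul _).deriv
    simp only [hF, h1, h2, Complex.real_inner_mul_mul_of_norm_eq_one hnorm]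
  have hWint : (∫ x in (0 : ℝ)..L, ∫ y in (-H)..H, W (x, y)) =
      (∫ x in (0 : ℝ)..L, G (x, H)) - ∫ x in (0 : ℝ)..L, G (x, -H) := by
    rw [← intervalIntegral.integral_congr fun x hx => intervalIntegral.integral_congr fun y hy =>
      hdiv _ (hmem hx hy), hdivthm, hsides]
    ring
  have hedge : ∀ y ∈ Icc (-H) H, IntervalIntegrable (fun x => W (x, y)) volume 0 L := fun y hy =>
    ContinuousOn.intervalIntegrable_of_Icc hL.le <|
      hWR.comp (f := fun x => (x, y)) (by fun_prop) fun x hx => ⟨hx, hy⟩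
  have hbR : ContinuousOn (fun p => 2 * ‖fderiv ℝ v p (0, 1)‖ ^ 2) R :=
    continuousOn_const.mul ((hb.continuousOn.mono hUrect).norm.pow 2)
  have hlhs : (∫ x₁ in (0 : ℝ)..L, ∫ x₂ in (-H)..H,
        (‖deriv (fun t => u t x₂) x₁‖ ^ 2 + ‖deriv (fun t => u x₁ t) x₂‖ ^ 2
          - κ * ‖u x₁ x₂‖ ^ 2)) =
      ∫ x in (0 : ℝ)..L, ∫ y in (-H)..H, (2 * ‖fderiv ℝ v (x, y) (0, 1)‖ ^ 2 - W (x, y)) := by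
    refine intervalIntegral.integral_congr fun x hx => intervalIntegral.integral_congr fun y hy => ?_
    have hxy := hUrect (hmem hx hy)
    simp only [d1 _ _ hxy, d2 _ _ hxy, hW, hv]
    ring
  have hrhs : (∫ x₁ in (0 : ℝ)..L, ∫ x₂ in (-H)..H, ‖deriv (fun t => u x₁ t) x₂‖ ^ 2) =
      ∫ x in (0 : ℝ)..L, ∫ y in (-H)..H, ‖fderiv ℝ v (x, y) (0, 1)‖ ^ 2 := by
    refine intervalIntegral.integral_congr fun x hx => intervalIntegral.integral_congr fun y hy => ?_
    simp only [d2 _ _ (hUrect (hmem hx hy))]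
  have hbdry : (∫ x₁ in (0 : ℝ)..L,
        ((‖deriv (fun t => u t H) x₁‖ ^ 2 - ‖deriv (fun t => u x₁ t) H‖ ^ 2
            - κ * ‖u x₁ H‖ ^ 2) +
         (‖deriv (fun t => u t (-H)) x₁‖ ^ 2 - ‖deriv (fun t => u x₁ t) (-H)‖ ^ 2
            - κ * ‖u x₁ (-H)‖ ^ 2))) =
      ∫ x in (0 : ℝ)..L, (-(W (x, H) + W (x, -H))) := by
    refine intervalIntegral.integral_congr fun x hx => ?_
    have hT := hUrect (hmem hx right_mem_uIcc)
    have hB := hUrect (hmem hx left_mem_uIcc)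
    simp only [d1 _ _ hT, d2 _ _ hT, d1 _ _ hB, d2 _ _ hB, hW, hv]
    ring
  rw [hlhs, hrhs, hbdry, intervalIntegral_intervalIntegral_sub
    (f := fun x y => 2 * ‖fderiv ℝ v (x, y) (0, 1)‖ ^ 2) (g := fun x y => W (x, y))
    hL.le hHH hbR hWR, hWint, intervalIntegral.integral_neg,
    intervalIntegral.integral_add (hedge H (right_mem_Icc.2 hHH)) (hedge (-H) (left_mem_Icc.2 hHH))]
  simp only [hG, intervalIntegral.integral_const_mul]
  ring
end

section
/- Let k > 0, ε_in > 1, d > 0, and k₂ ∈ (0, π/(2d)) satisfy k₂²·(1 + tan²(k₂d)) = k²·(ε_in − 1). Set k₃ := k₂·tan(k₂d), k₁ := √(k²ε_in − k₂²), and C := cos(k₂d)·e^{k₃d}, and define u(x₁,x₂) := C·e^{ik₁x₁}·e^{−k₃x₂} for x₂ ≥ d, u(x₁,x₂) := e^{ik₁x₁}·cos(k₂x₂) for |x₂| ≤ d, and u(x₁,x₂) := C·e^{ik₁x₁}·e^{k₃x₂} for x₂ ≤ −d. Then: (a) k₃ > 0 and k₁² − k₃² = k²; (b) u and ∂u/∂x₂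 are continuous across x₂ = d and x₂ = −d; (c) Δu + k²ε_in·u = 0 on the strip {|x₂| < d} and Δu + k²·u = 0 on each of the half-planes {x₂ > d} and {x₂ < −d}; (d) |u(x₁,x₂)| = C·e^{−k₃|x₂|} for |x₂| ≥ d, so u decays exponentially as |x₂| → ∞, and u is not identically zero. -/
/-- Two differentiable functions whose values and derivatives agree on the frontier of a set glue
along this set to a differentiable function. -/
theorem hasDerivAt_ite_of_frontier {E : Type*} [NormedAddCommGroup E] [NormedSpace ℝ E]
    {p : ℝ → Prop} [DecidablePred p] {f g f' g' : ℝ → E}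
    (hf : ∀ t, HasDerivAt f (f' t) t) (hg : ∀ t, HasDerivAt g (g' t) t)
    (h : ∀ t ∈ frontier {t | p t}, f t = g t) (h' : ∀ t ∈ frontier {t | p t}, f' t = g' t)
    (t : ℝ) :
    HasDerivAt (fun s => if p s then f s else g s) (if p t then f' t else g' t) t := by
  by_cases hint : t ∈ interior {t | p t}
  · have hp : p t := interior_subset hint
    rw [if_pos hp]
    refine (hf t).congr_of_eventuallyEq ?_
    filter_upwards [mem_interior_iff_mem_nhds.1 hint] with s hs using if_pos hs
  by_cases hcl : t ∈ closure {t | p t}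
  · have hfr : t ∈ frontier {t | p t} := ⟨hcl, hint⟩
    have hval : (if p t then f t else g t) = f t := by split_ifs <;> simp [h t hfr]
    have hder : (if p t then f' t else g' t) = f' t := by split_ifs <;> simp [h' t hfr]
    rw [hder, ← hasDerivWithinAt_univ, ← Set.union_compl_self {t | p t}]
    refine HasDerivWithinAt.union ?_ ?_
    · exact (hf t).hasDerivWithinAt.congr (fun s hs => if_pos hs) hval
    · rw [h' t hfr]
      exact (hg t).hasDerivWithinAt.congr (fun s hs => if_neg hs) (hval.trans (h t hfr))
  · have hp : ¬ p t := fun hp => hcl (subset_closure hp)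
    rw [if_neg hp]
    refine (hg t).congr_of_eventuallyEq ?_
    filter_upwards [isClosed_closure.isOpen_compl.mem_nhds hcl] with s hs
    exact if_neg fun hps => hs (subset_closure hps)

/-- The vertical profile of the guided mode: cosine in the slab, exponential decay outside. -/
noncomputable def guidedProfile (d k₂ k₃ C t : ℝ) : ℝ :=
  if d ≤ t then C * Real.exp (-(k₃ * t))
  else if t ≤ -d then C * Real.exp (k₃ * t) else Real.cos (k₂ * t)

/-- The derivative of `guidedProfile` for parameters satisfying the transmission conditions. -/
noncomputable def guidedProfileDeriv (d k₂ k₃ C t : ℝ) : ℝ :=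
  if d ≤ t then -(k₃ * (C * Real.exp (-(k₃ * t))))
  else if t ≤ -d then k₃ * (C * Real.exp (k₃ * t)) else -(k₂ * Real.sin (k₂ * t))

section GuidedProfile

variable {d k₂ k₃ C : ℝ}

theorem hasDerivAt_const_mul_exp (C a t : ℝ) :
    HasDerivAt (fun s => C * Real.exp (a * s)) (a * (C * Real.exp (a * t))) t := by
  refine (((hasDerivAt_id' t).const_mul a).exp.const_mul C).congr_deriv ?_
  ring

theorem hasDerivAt_const_mul_exp_neg (C a t : ℝ) :
    HasDerivAt (fun s => C * Real.exp (-(a * s))) (-(a * (C * Real.exp (-(a * t))))) t := by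
  simpa only [neg_mul] using hasDerivAt_const_mul_exp C (-a) t

theorem hasDerivAt_cos_const_mul (a t : ℝ) :
    HasDerivAt (fun s => Real.cos (a * s)) (-(a * Real.sin (a * t))) t := by
  refine ((hasDerivAt_id' t).const_mul a).cos.congr_deriv ?_
  ring

theorem hasDerivAt_sin_const_mul (a t : ℝ) :
    HasDerivAt (fun s => Real.sin (a * s)) (a * Real.cos (a * t)) t := by
  refine ((hasDerivAt_id' t).const_mul a).sin.congr_deriv ?_
  ring

theorem hasDerivAt_guidedProfile (hd : 0 < d) (hval : C * Real.exp (-(k₃ * d)) = Real.cos (k₂ * d))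
    (hder : k₃ * Real.cos (k₂ * d) = k₂ * Real.sin (k₂ * d)) (t : ℝ) :
    HasDerivAt (guidedProfile d k₂ k₃ C) (guidedProfileDeriv d k₂ k₃ C t) t := by
  have hlt : ¬ d ≤ -d := by linarith
  refine hasDerivAt_ite_of_frontier (p := fun s => d ≤ s)
    (g := fun s => if s ≤ -d then C * Real.exp (k₃ * s) else Real.cos (k₂ * s))
    (g' := fun s => if s ≤ -d then k₃ * (C * Real.exp (k₃ * s)) else -(k₂ * Real.sin (k₂ * s)))
    (hasDerivAt_const_mul_exp_neg C k₃)
    (hasDerivAt_ite_of_frontier (p := fun s => s ≤ -d) (hasDerivAt_const_mul_exp C k₃)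
      (hasDerivAt_cos_const_mul k₂) ?_ ?_) ?_ ?_ t
  · rintro s hs
    obtain rfl : s = -d := frontier_Iic_subset (-d) hs
    simp [mul_neg, hval]
  · rintro s hs
    obtain rfl : s = -d := frontier_Iic_subset (-d) hs
    simp [mul_neg, hval, hder]
  · rintro s hs
    obtain rfl : s = d := frontier_Ici_subset d hs
    simp [hlt, hval]
  · rintro s hs
    obtain rfl : s = d := frontier_Ici_subset d hs
    simp [hlt, hval, hder]

theorem continuous_guidedProfileDeriv (hd : 0 < d)
    (hval : C * Real.exp (-(k₃ * d)) = Real.cos (k₂ * d))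
    (hder : k₃ * Real.cos (k₂ * d) = k₂ * Real.sin (k₂ * d)) :
    Continuous (guidedProfileDeriv d k₂ k₃ C) := by
  have hlt : ¬ d ≤ -d := by linarith
  refine Continuous.if_le (by fun_prop) (Continuous.if_le (by fun_prop) (by fun_prop)
    continuous_id continuous_const ?_) continuous_const continuous_id ?_
  · rintro s rfl
    simp [mul_neg, hval, hder]
  · rintro s rfl
    simp [hlt, hval, hder]

theorem hasDerivAt_guidedProfileDeriv_of_abs_lt {t : ℝ} (ht : |t| < d) :
    HasDerivAt (guidedProfileDeriv d k₂ k₃ C) (-(k₂ ^ 2 * guidedProfile d k₂ k₃ C t)) t := by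
  have hform : ∀ s ∈ Set.Ioo (-d) d, ¬ d ≤ s ∧ ¬ s ≤ -d := fun s hs =>
    ⟨not_le.2 hs.2, not_le.2 hs.1⟩
  have hmem : t ∈ Set.Ioo (-d) d := abs_lt.1 ht
  have hv : guidedProfile d k₂ k₃ C t = Real.cos (k₂ * t) := by
    simp only [guidedProfile, hform t hmem, if_false]
  have := ((hasDerivAt_sin_const_mul k₂ t).const_mul k₂).neg
  rw [hv, sq, mul_assoc]
  refine this.congr_of_eventuallyEq ?_
  filter_upwards [isOpen_Ioo.mem_nhds hmem] with s hs
  simp only [guidedProfileDeriv, hform s hs, if_false, Pi.neg_apply]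

theorem hasDerivAt_guidedProfileDeriv_of_lt {t : ℝ} (ht : d < t) :
    HasDerivAt (guidedProfileDeriv d k₂ k₃ C) (k₃ ^ 2 * guidedProfile d k₂ k₃ C t) t := by
  have hv : guidedProfile d k₂ k₃ C t = C * Real.exp (-(k₃ * t)) := if_pos ht.le
  have := ((hasDerivAt_const_mul_exp_neg C k₃ t).const_mul k₃).neg
  rw [hv]
  refine (this.congr_of_eventuallyEq ?_).congr_deriv (by ring)
  filter_upwards [lt_mem_nhds ht] with s hs using if_pos hs.le

theorem hasDerivAt_guidedProfileDeriv_of_lt_neg (hd : 0 < d) {t : ℝ} (ht : t < -d) :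
    HasDerivAt (guidedProfileDeriv d k₂ k₃ C) (k₃ ^ 2 * guidedProfile d k₂ k₃ C t) t := by
  have hform : ∀ s < -d, ¬ d ≤ s ∧ s ≤ -d := fun s hs => ⟨by linarith, hs.le⟩
  have hv : guidedProfile d k₂ k₃ C t = C * Real.exp (k₃ * t) := by
    simp only [guidedProfile, hform t ht, if_false, if_true]
  have := (hasDerivAt_const_mul_exp C k₃ t).const_mul k₃
  rw [hv, sq, mul_assoc]
  refine this.congr_of_eventuallyEq ?_
  filter_upwards [gt_mem_nhds ht] with s hs
  simp only [guidedProfileDeriv, hform s hs, if_false, if_true]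

theorem guidedProfile_of_le_abs (hd : 0 < d) {t : ℝ} (ht : d ≤ |t|) :
    guidedProfile d k₂ k₃ C t = C * Real.exp (-(k₃ * |t|)) := by
  unfold guidedProfile
  rcases le_abs.1 ht with h | h
  · rw [if_pos h, abs_of_pos (hd.trans_le h)]
  · rw [if_neg (by linarith), if_pos (by linarith), abs_of_neg (by linarith), mul_neg, neg_neg]

end GuidedProfile

theorem deriv_deriv_cexp_mul_const (c b : ℂ) (x : ℝ) :
    deriv (deriv fun t : ℝ => Complex.exp (c * t) * b) x = c ^ 2 * (Complex.exp (c * x) * b) := by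
  have h : ∀ (b : ℂ) (t : ℝ), HasDerivAt (fun t : ℝ => Complex.exp (c * t) * b)
      (Complex.exp (c * t) * (c * b)) t := fun b t => by
    refine (((hasDerivAt_id' t).ofReal_comp.const_mul c).cexp.mul_const b).congr_deriv ?_
    rw [Complex.ofReal_one]
    ring
  rw [funext fun t => (h b t).deriv, (h (c * b) x).deriv]
  ring

/-- The guided mode of Section 5.3.1: a nonzero quasi-periodic solution of the Helmholtz
transmission problem for the slab `{|x₂| < d}` of permittivity `ε_in` (with `ε = 1` outside)
that decays exponentially in the vertical direction. -/
theorem guided_mode_existence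
    (k εin d k₁ k₂ k₃ C : ℝ)
    (hk : 0 < k) (hεin : 1 < εin) (hd : 0 < d)
    (hk₂pos : 0 < k₂) (hk₂lt : k₂ < Real.pi / (2 * d))
    (hdisp : k₂ ^ 2 * (1 + Real.tan (k₂ * d) ^ 2) = k ^ 2 * (εin - 1))
    (hk₃ : k₃ = k₂ * Real.tan (k₂ * d))
    (hk₁ : k₁ = Real.sqrt (k ^ 2 * εin - k₂ ^ 2))
    (hC : C = Real.cos (k₂ * d) * Real.exp (k₃ * d))
    (u : ℝ → ℝ → ℂ)
    (hu : ∀ x₁ x₂ : ℝ, u x₁ x₂ =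
      if d ≤ x₂ then
        (C : ℂ) * Complex.exp (Complex.I * (k₁ : ℂ) * (x₁ : ℂ)) *
          Complex.exp (-((k₃ : ℂ) * (x₂ : ℂ)))
      else if x₂ ≤ -d then
        (C : ℂ) * Complex.exp (Complex.I * (k₁ : ℂ) * (x₁ : ℂ)) *
          Complex.exp ((k₃ : ℂ) * (x₂ : ℂ))
      else
        Complex.exp (Complex.I * (k₁ : ℂ) * (x₁ : ℂ)) * ((Real.cos (k₂ * x₂) : ℝ) : ℂ)) :
    -- (a)
    (0 < k₃ ∧ k₁ ^ 2 - k₃ ^ 2 = k ^ 2) ∧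
    -- (b) continuity of u and ∂u/∂x₂ across x₂ = d and x₂ = −d
    (∀ x₁ : ℝ,
      ContinuousAt (fun t => u x₁ t) d ∧ ContinuousAt (fun t => u x₁ t) (-d) ∧
      ContinuousAt (deriv (fun t => u x₁ t)) d ∧
      ContinuousAt (deriv (fun t => u x₁ t)) (-d)) ∧
    -- (c) Helmholtz equations in the three regions
    (∀ x₁ x₂ : ℝ,
      (|x₂| < d →
        deriv (deriv (fun t => u t x₂)) x₁ + deriv (deriv (fun t => u x₁ t)) x₂ +
          ((k ^ 2 * εin : ℝ) : ℂ) * u x₁ x₂ = 0) ∧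
      (d < x₂ →
        deriv (deriv (fun t => u t x₂)) x₁ + deriv (deriv (fun t => u x₁ t)) x₂ +
          (k : ℂ) ^ 2 * u x₁ x₂ = 0) ∧
      (x₂ < -d →
        deriv (deriv (fun t => u t x₂)) x₁ + deriv (deriv (fun t => u x₁ t)) x₂ +
          (k : ℂ) ^ 2 * u x₁ x₂ = 0)) ∧
    -- (d) exponential decay and nontriviality
    (∀ x₁ x₂ : ℝ, d ≤ |x₂| → ‖u x₁ x₂‖ = C * Real.exp (-(k₃ * |x₂|))) ∧
    (∃ x₁ x₂ : ℝ, u x₁ x₂ ≠ 0) := by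
  have hkd : k₂ * d < Real.pi / 2 := by
    rw [lt_div_iff₀ (by positivity)] at hk₂lt
    linarith
  have hcos : 0 < Real.cos (k₂ * d) :=
    Real.cos_pos_of_mem_Ioo ⟨by linarith [mul_pos hk₂pos hd, Real.pi_pos], hkd⟩
  have hk₃pos : 0 < k₃ :=
    hk₃ ▸ mul_pos hk₂pos (Real.tan_pos_of_pos_of_lt_pi_div_two (mul_pos hk₂pos hd) hkd)
  have hdisp' : k ^ 2 * εin - k₂ ^ 2 = k ^ 2 + k₃ ^ 2 := by
    rw [hk₃]; linarith
  have hk₁sq : k₁ ^ 2 = k ^ 2 + k₃ ^ 2 := by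
    rw [hk₁, Real.sq_sqrt] <;> rw [hdisp']
    positivity
  have hCpos : 0 < C := hC ▸ mul_pos hcos (Real.exp_pos _)
  have hval : C * Real.exp (-(k₃ * d)) = Real.cos (k₂ * d) := by
    rw [hC, mul_assoc, ← Real.exp_add, add_neg_cancel, Real.exp_zero, mul_one]
  have hder : k₃ * Real.cos (k₂ * d) = k₂ * Real.sin (k₂ * d) := by
    rw [hk₃, mul_assoc, Real.tan_mul_cos hcos.ne']
  set v := guidedProfile d k₂ k₃ C with hv
  set w := guidedProfileDeriv d k₂ k₃ C
  have huv : ∀ x₁ x₂ : ℝ, u x₁ x₂ = Complex.exp (Complex.I * k₁ * x₁) * (v x₂ : ℂ) := by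
    intro x₁ x₂
    rw [hu, hv, guidedProfile]
    split_ifs
    · push_cast; ring
    · push_cast; ring
    · rfl
  obtain rfl : u = fun x₁ x₂ : ℝ => Complex.exp (Complex.I * k₁ * x₁) * (v x₂ : ℂ) :=
    funext fun x₁ => funext (huv x₁)
  have hvw : ∀ t, HasDerivAt v (w t) t := hasDerivAt_guidedProfile hd hval hder
  have hwc : Continuous w := continuous_guidedProfileDeriv hd hval hder
  have hvc : Continuous v := continuous_iff_continuousAt.2 fun t => (hvw t).continuousAt
  have hd₂ : ∀ x₁ : ℝ, deriv (fun t : ℝ => Complex.exp (Complex.I * k₁ * x₁) * (v t : ℂ)) =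
      fun t => Complex.exp (Complex.I * k₁ * x₁) * (w t : ℂ) := fun x₁ =>
    funext fun t => ((hvw t).ofReal_comp.const_mul _).deriv
  have hlap : ∀ (x₁ x₂ q : ℝ), HasDerivAt w (q * v x₂) x₂ → ∀ K : ℝ, K = k₁ ^ 2 - q →
      deriv (deriv fun t : ℝ => Complex.exp (Complex.I * k₁ * t) * (v x₂ : ℂ)) x₁ +
        deriv (deriv fun t : ℝ => Complex.exp (Complex.I * k₁ * x₁) * (v t : ℂ)) x₂ +
        (K : ℂ) * (Complex.exp (Complex.I * k₁ * x₁) * (v x₂ : ℂ)) = 0 := by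
    rintro x₁ x₂ q hq K rfl
    rw [deriv_deriv_cexp_mul_const, hd₂, (hq.ofReal_comp.const_mul _).deriv, mul_pow,
      Complex.I_sq]
    push_cast
    ring
  refine ⟨⟨hk₃pos, by linarith⟩, fun x₁ => ?_, fun x₁ x₂ => ⟨fun h => ?_, fun h => ?_, fun h => ?_⟩,
    fun x₁ x₂ h => ?_, 0, d, ?_⟩
  · simp only [hd₂]
    have h₀ : Continuous fun t : ℝ => Complex.exp (Complex.I * k₁ * x₁) * (v t : ℂ) := by fun_prop
    have h₁ : Continuous fun t : ℝ => Complex.exp (Complex.I * k₁ * x₁) * (w t : ℂ) := by fun_prop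
    exact ⟨h₀.continuousAt, h₀.continuousAt, h₁.continuousAt, h₁.continuousAt⟩
  · refine hlap x₁ x₂ (-k₂ ^ 2) ?_ _ (by linarith)
    rw [neg_mul]
    exact hasDerivAt_guidedProfileDeriv_of_abs_lt h
  · rw [← Complex.ofReal_pow]
    exact hlap x₁ x₂ (k₃ ^ 2) (hasDerivAt_guidedProfileDeriv_of_lt h) _ (by linarith)
  · rw [← Complex.ofReal_pow]
    exact hlap x₁ x₂ (k₃ ^ 2) (hasDerivAt_guidedProfileDeriv_of_lt_neg hd h) _ (by linarith)
  · have hnorm : ‖Complex.exp (Complex.I * k₁ * x₁)‖ = 1 := by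
      rw [mul_assoc, ← Complex.ofReal_mul, Complex.norm_exp_I_mul_ofReal]
    rw [norm_mul, hnorm, one_mul, Complex.norm_real, hv, guidedProfile_of_le_abs hd h,
      Real.norm_of_nonneg (by positivity)]
  · have hvd : v d = Real.cos (k₂ * d) := by
      rw [hv, guidedProfile, if_pos le_rfl, hval]
    beta_reduce
    rw [hvd]
    exact mul_ne_zero (Complex.exp_ne_zero _) (Complex.ofReal_ne_zero.2 hcos.ne')
end
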